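/- arXiv:1102.1698 — 10 statements merged into one kernel-verified Lean document; each statement's English description precedes it below -/
import Mathlib

section
/- Let g be a real Lie algebra, J : g → g an ℝ-linear map with J² = −id, and B : g × g → g an ℝ-bilinear map which is complex, i.e. B(x,Jy) = J B(x,y) for all x, y. If the torsion T(x,y) = B(x,y) − B(y,x) − [x,y] is of type (2,0), i.e. T(Jx,y) = J T(x,y) for all x, y, then the Nijenhuis tensor N of J vanishes identically. -/
/-- Proposition 2.3 (ii), at the Lie-algebra level: if `B` is a complex bilinear
map whose torsion `T x y = B x y - B y x - ⁅x,y⁆` is of type `(2,0)`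
(i.e. `T (Jx) y = J (T x y)`), then the Nijenhuis tensor of `J` vanishes. -/
theorem integrable_of_torsion_type_two_zero (g : Type*) [LieRing g] [LieAlgebra ℝ g]
    (J : g →ₗ[ℝ] g) (hJ : ∀ x, J (J x) = -x)
    (B : g →ₗ[ℝ] g →ₗ[ℝ] g) (hB : ∀ x y, B x (J y) = J (B x y))
    (hT : ∀ x y : g,
      B (J x) y - B y (J x) - ⁅J x, y⁆ = J (B x y - B y x - ⁅x, y⁆)) :
    ∀ x y : g, ⁅J x, J y⁆ - J ⁅x, J y⁆ - J ⁅J x, y⁆ - ⁅x, y⁆ = 0 := by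
  have bracket_defect : ∀ x y : g, ⁅J x, y⁆ = J ⁅x, y⁆ + B (J x) y - J (B x y) := by
    intro x y
    have h := hT x y
    rw [hB, map_sub, map_sub] at h
    linear_combination (norm := module) (-1 : ℝ) • h
  intro x y
  rw [bracket_defect x (J y), bracket_defect x y, hB, hB]
  simp only [map_add, map_sub, hJ]
  abel
end

section
/- Let g be a real Lie algebra, J : g → g an ℝ-linear map with J² = −id whose Nijenhuis tensor vanishes identically, and B : g × g → g an ℝ-bilinear map which is complex, i.e. B(x,Jy) = J B(x,y) for all x, y. If the torsion T(x,y) = B(x,y) − B(y,x) − [x,y] is of type (2,0)+(0,2), i.e. T(Jx,Jy) = −T(x,y) for all x, y, then T is of type (2,0), i.e. T(Jx,y) = J T(x,y) for all x, y. -/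
/-- Proposition 2.3 (iii), at the Lie-algebra level: if the Nijenhuis tensor of
`J` vanishes and `B` is a complex bilinear map whose torsion
`T x y = B x y - B y x - ⁅x,y⁆` is of type `(2,0)+(0,2)`
(i.e. `T (Jx) (Jy) = - T x y`), then `T` is of type `(2,0)`
(i.e. `T (Jx) y = J (T x y)`). -/
theorem torsion_two_zero_of_two_zero_plus_zero_two (g : Type*) [LieRing g] [LieAlgebra ℝ g]
    (J : g →ₗ[ℝ] g) (hJ : ∀ x, J (J x) = -x)
    (hN : ∀ x y : g, ⁅J x, J y⁆ - J ⁅x, J y⁆ - J ⁅J x, y⁆ - ⁅x, y⁆ = 0)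
    (B : g →ₗ[ℝ] g →ₗ[ℝ] g) (hB : ∀ x y, B x (J y) = J (B x y))
    (hT : ∀ x y : g,
      B (J x) (J y) - B (J y) (J x) - ⁅J x, J y⁆ = -(B x y - B y x - ⁅x, y⁆)) :
    ∀ x y : g,
      B (J x) y - B y (J x) - ⁅J x, y⁆ = J (B x y - B y x - ⁅x, y⁆) := by
  intro x y
  have hT' := hT (J x) y
  have hJT := congrArg J (hT x y)
  have hJN := congrArg J (hN x y)
  simp only [hJ, hB, map_neg, map_sub, map_zero, LinearMap.neg_apply, neg_lie] at hT' hJT hJN ⊢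
  linear_combination (norm := module) (1 / 2 : ℝ) • (hT' - hJT - hJN)
end

section
/- Let g be a real Lie algebra and J : g → g an ℝ-linear map with J² = −id whose Nijenhuis tensor vanishes identically. Let B̄ : g × g → g be an ℝ-bilinear map which is torsion-free, i.e. B̄(x,y) − B̄(y,x) = [x,y] for all x, y. Define B(x,y) := (1/2)(B̄(x,y) − J B̄(x,Jy)). Then B is complex, i.e. B(x,Jy) = J B(x,y) for all x, y, and its torsion T(x,y) = B(x,y) − B(y,x) − [x,y] is of type (1,1), i.e. T(Jx,Jy) = T(x,y) for all x, y. -/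
/-- Remark 2.5 of the paper, at the Lie-algebra level: if the Nijenhuis tensor
of `J` vanishes and `B̄` is torsion-free (`B̄ x y - B̄ y x = ⁅x,y⁆`), then
`B x y := (1/2) • (B̄ x y - J (B̄ x (J y)))` is complex (`B x (Jy) = J (B x y)`)
and its torsion `T x y = B x y - B y x - ⁅x,y⁆` is of type `(1,1)`
(`T (Jx) (Jy) = T x y`). -/
theorem complex_one_one_connection_from_torsion_free (g : Type*) [LieRing g] [LieAlgebra ℝ g]
    (J : g →ₗ[ℝ] g) (hJ : ∀ x, J (J x) = -x)
    (hN : ∀ x y : g, ⁅J x, J y⁆ - J ⁅x, J y⁆ - J ⁅J x, y⁆ - ⁅x, y⁆ = 0)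
    (Bbar : g →ₗ[ℝ] g →ₗ[ℝ] g) (htf : ∀ x y, Bbar x y - Bbar y x = ⁅x, y⁆) :
    let B : g → g → g := fun x y => (2⁻¹ : ℝ) • (Bbar x y - J (Bbar x (J y)))
    let T : g → g → g := fun x y => B x y - B y x - ⁅x, y⁆
    (∀ x y : g, B x (J y) = J (B x y)) ∧
      (∀ x y : g, T (J x) (J y) = T x y) := by
  intro B T
  constructor
  · intro x y
    simp only [B, hJ, map_neg, map_sub, map_smul]
    module
  · intro x y
    have h := hN x y
    simp only [← htf, map_sub] at h
    simp only [T, B, ← htf, hJ, map_neg]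
    linear_combination (norm := module) (-2⁻¹ : ℝ) • h
end

section
/- Let g be a real Lie algebra and J : g → g an ℝ-linear map with J² = −id. Then the subspace g^{1,0} of the complexification g^ℂ is abelian, i.e. [Z,W] = 0 for all Z, W ∈ g^{1,0}, if and only if [Jx,Jy] = [x,y] for all x, y ∈ g (in particular, in this case g^{1,0} is an abelian complex Lie subalgebra of g^ℂ). -/
open scoped TensorProduct

/-- A bracket in the complexification, split into its real and imaginary parts. -/
theorem lie_one_tmul_sub_I_tmul {g : Type*} [LieRing g] [LieAlgebra ℝ g] (x x' y y' : g) :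
    ⁅(1 : ℂ) ⊗ₜ[ℝ] x - Complex.I ⊗ₜ[ℝ] x', (1 : ℂ) ⊗ₜ[ℝ] y - Complex.I ⊗ₜ[ℝ] y'⁆ =
      (1 : ℂ) ⊗ₜ[ℝ] (⁅x, y⁆ - ⁅x', y'⁆) - Complex.I ⊗ₜ[ℝ] (⁅x, y'⁆ + ⁅x', y⁆) := by
  simp only [lie_sub, sub_lie, LieAlgebra.ExtendScalars.bracket_tmul, one_mul, mul_one,
    Complex.I_mul_I, TensorProduct.neg_tmul, TensorProduct.tmul_sub, TensorProduct.tmul_add]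
  abel

/-- If `a - i·b` vanishes in the complexification, then so does its real part `a`. -/
theorem eq_zero_of_one_tmul_sub_I_tmul_eq_zero {V : Type*} [AddCommGroup V] [Module ℝ V]
    {a b : V} (h : (1 : ℂ) ⊗ₜ[ℝ] a - Complex.I ⊗ₜ[ℝ] b = 0) : a = 0 := by
  simpa using congrArg (TensorProduct.lid ℝ V ∘ Complex.reLm.rTensor V) h

/-- For a real Lie algebra `g` with an almost complex structure `J`, the
subspace `g^{1,0} = { x - i·Jx : x ∈ g }` of the complexification `ℂ ⊗[ℝ] g`
is abelian (all brackets of its elements vanish) if and only if `J` is abelian,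
i.e. `⁅Jx,Jy⁆ = ⁅x,y⁆` for all `x, y ∈ g`. -/
theorem oneZero_abelian_iff_abelian_complex_structure (g : Type*) [LieRing g] [LieAlgebra ℝ g]
    (J : g →ₗ[ℝ] g) (hJ : ∀ x, J (J x) = -x) :
    (∀ Z ∈ {z : ℂ ⊗[ℝ] g | ∃ x : g, z = (1 : ℂ) ⊗ₜ[ℝ] x - Complex.I ⊗ₜ[ℝ] (J x)},
     ∀ W ∈ {z : ℂ ⊗[ℝ] g | ∃ x : g, z = (1 : ℂ) ⊗ₜ[ℝ] x - Complex.I ⊗ₜ[ℝ] (J x)},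
      ⁅Z, W⁆ = (0 : ℂ ⊗[ℝ] g)) ↔
    (∀ x y : g, ⁅J x, J y⁆ = ⁅x, y⁆) := by
  constructor
  · intro h x y
    have hxy := h _ ⟨x, rfl⟩ _ ⟨y, rfl⟩
    rw [lie_one_tmul_sub_I_tmul] at hxy
    exact (sub_eq_zero.mp (eq_zero_of_one_tmul_sub_I_tmul_eq_zero hxy)).symm
  · rintro h _ ⟨x, rfl⟩ _ ⟨y, rfl⟩
    have hmixed : ⁅x, J y⁆ + ⁅J x, y⁆ = 0 := by
      rw [← h x (J y), hJ, lie_neg, neg_add_cancel]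
    rw [lie_one_tmul_sub_I_tmul, h, sub_self, hmixed, TensorProduct.tmul_zero,
      TensorProduct.tmul_zero, sub_zero]
end

section
/- Let g be a real Lie algebra and J : g → g an ℝ-linear map with J² = −id. Then the subspace g^{1,0} of the complexification g^ℂ is an ideal of g^ℂ, i.e. [Z,W] ∈ g^{1,0} for all Z ∈ g^{1,0} and all W ∈ g^ℂ, if and only if J[x,y] = [x,Jy] for all x, y ∈ g. -/
open scoped TensorProduct

/-- Elements of the complexification are determined by their real and imaginary parts. -/
theorem one_tmul_sub_I_tmul_inj {V : Type*} [AddCommGroup V] [Module ℝ V] {a b c d : V}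
    (h : (1 : ℂ) ⊗ₜ[ℝ] a - Complex.I ⊗ₜ[ℝ] b = (1 : ℂ) ⊗ₜ[ℝ] c - Complex.I ⊗ₜ[ℝ] d) :
    a = c ∧ b = d := by
  have hre := congrArg (fun z => TensorProduct.lid ℝ V (Complex.reLm.rTensor V z)) h
  have him := congrArg (fun z => TensorProduct.lid ℝ V (Complex.imLm.rTensor V z)) h
  exact ⟨by simpa using hre, by simpa using him⟩

/-- Multiplying `1 ⊗ c - i ⊗ J c` by a complex scalar gives an element of the same form. -/
theorem tmul_sub_mul_I_tmul_eq {V : Type*} [AddCommGroup V] [Module ℝ V]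
    (J : V →ₗ[ℝ] V) (hJ : ∀ x, J (J x) = -x) (a : ℂ) (c : V) :
    a ⊗ₜ[ℝ] c - (Complex.I * a) ⊗ₜ[ℝ] J c =
      (1 : ℂ) ⊗ₜ[ℝ] (a.re • c + a.im • J c) -
        Complex.I ⊗ₜ[ℝ] J (a.re • c + a.im • J c) := by
  have ha : a = a.re • (1 : ℂ) + a.im • Complex.I := by
    apply Complex.ext <;> simp
  have hIa : Complex.I * a = a.re • Complex.I - a.im • (1 : ℂ) := by
    apply Complex.ext <;> simp
  rw [hIa]
  nth_rewrite 1 [ha]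
  simp only [map_add, map_smul, hJ, TensorProduct.add_tmul, TensorProduct.sub_tmul,
    TensorProduct.tmul_add, TensorProduct.smul_tmul, TensorProduct.tmul_smul,
    TensorProduct.tmul_neg, smul_neg]
  abel

/-- For a real Lie algebra `g` with an almost complex structure `J`, the
subspace `g^{1,0} = { x - i·Jx : x ∈ g }` of the complexification `ℂ ⊗[ℝ] g`
is an ideal (i.e. `⁅Z, W⁆ ∈ g^{1,0}` for every `Z ∈ g^{1,0}` and every
`W ∈ ℂ ⊗[ℝ] g`) if and only if `J` is bi-invariant, i.e. `J⁅x,y⁆ = ⁅x,Jy⁆`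
for all `x, y ∈ g`. -/
theorem oneZero_ideal_iff_biinvariant (g : Type*) [LieRing g] [LieAlgebra ℝ g]
    (J : g →ₗ[ℝ] g) (hJ : ∀ x, J (J x) = -x) :
    (∀ Z ∈ {z : ℂ ⊗[ℝ] g | ∃ x : g, z = (1 : ℂ) ⊗ₜ[ℝ] x - Complex.I ⊗ₜ[ℝ] (J x)},
     ∀ W : ℂ ⊗[ℝ] g,
      ⁅Z, W⁆ ∈ {z : ℂ ⊗[ℝ] g | ∃ x : g, z = (1 : ℂ) ⊗ₜ[ℝ] x - Complex.I ⊗ₜ[ℝ] (J x)}) ↔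
    (∀ x y : g, J ⁅x, y⁆ = ⁅x, J y⁆) := by
  constructor
  · intro h
    have hleft (x y : g) : J ⁅x, y⁆ = ⁅J x, y⁆ := by
      obtain ⟨u, hu⟩ := h _ ⟨x, rfl⟩ ((1 : ℂ) ⊗ₜ[ℝ] y)
      rw [sub_lie, LieAlgebra.ExtendScalars.bracket_tmul,
        LieAlgebra.ExtendScalars.bracket_tmul, mul_one, mul_one] at hu
      obtain ⟨hxy, hJxy⟩ := one_tmul_sub_I_tmul_inj hu
      rw [hxy, hJxy]
    intro x y
    rw [← lie_skew, map_neg, hleft, lie_skew]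
  · rintro h _ ⟨x, rfl⟩ W
    have hleft (y : g) : ⁅J x, y⁆ = J ⁅x, y⁆ := by
      rw [← lie_skew, ← h, ← map_neg, lie_skew]
    induction W using TensorProduct.induction_on with
    | zero => exact ⟨0, by simp⟩
    | tmul a y =>
      refine ⟨a.re • ⁅x, y⁆ + a.im • J ⁅x, y⁆, ?_⟩
      rw [← tmul_sub_mul_I_tmul_eq J hJ, sub_lie, LieAlgebra.ExtendScalars.bracket_tmul,
        LieAlgebra.ExtendScalars.bracket_tmul, one_mul, hleft]
    | add W₁ W₂ h₁ h₂ =>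
      obtain ⟨u₁, hu₁⟩ := h₁
      obtain ⟨u₂, hu₂⟩ := h₂
      refine ⟨u₁ + u₂, (lie_add (L := ℂ ⊗[ℝ] g) (M := ℂ ⊗[ℝ] g) _ W₁ W₂).trans ?_⟩
      rw [hu₁, hu₂, map_add, TensorProduct.tmul_add, TensorProduct.tmul_add]
      abel
end

section
/- Let g be a real Lie algebra and J : g → g an ℝ-linear map with J² = −id. If J is both abelian ([Jx,Jy] = [x,y] for all x, y) and bi-invariant (J[x,y] = [x,Jy] for all x, y), then the Lie bracket of g is trivial, i.e. [x,y] = 0 for all x, y ∈ g. -/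
/-- A complex structure on a Lie algebra cannot be both abelian and
bi-invariant unless the Lie bracket is trivial. -/
theorem bracket_trivial_of_abelian_and_biinvariant (g : Type*) [LieRing g] [LieAlgebra ℝ g]
    (J : g →ₗ[ℝ] g) (hJ : ∀ x, J (J x) = -x)
    (habel : ∀ x y : g, ⁅J x, J y⁆ = ⁅x, y⁆)
    (hbi : ∀ x y : g, J ⁅x, y⁆ = ⁅x, J y⁆) :
    ∀ x y : g, ⁅x, y⁆ = 0 := by
  intro x y
  have h : ⁅x, y⁆ = -⁅x, y⁆ := calc
    ⁅x, y⁆ = ⁅J x, J y⁆ := (habel x y).symm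
    _ = J ⁅J x, y⁆ := (hbi (J x) y).symm
    _ = -J (J ⁅y, x⁆) := by rw [hbi y x, ← lie_skew, map_neg]
    _ = -⁅x, y⁆ := by rw [hJ, lie_skew]
  have h2 : (2 : ℝ) • ⁅x, y⁆ = 0 := by
    rw [two_smul]
    exact eq_neg_iff_add_eq_zero.mp h
  exact (smul_eq_zero.mp h2).resolve_left two_ne_zero
end

section
/- Let g be a real Lie algebra admitting an abelian complex structure, i.e. an ℝ-linear map J : g → g with J² = −id and [Jx,Jy] = [x,y] for all x, y ∈ g. Then g is 2-step solvable: [[x,y],[z,w]] = 0 for all x, y, z, w ∈ g; equivalently, the derived subalgebra [g,g] is abelian. -/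
open scoped TensorProduct

/-- If a Lie ring is the sum of two additive subgroups `A` and `B` on which the bracket vanishes,
brackets of the form `⁅⁅a₁, b₁⁆, ⁅a₂, b₂⁆⁆` with `aᵢ ∈ A` and `bᵢ ∈ B` are zero. -/
theorem lie_lie_lie_eq_zero_of_mem {L : Type*} [LieRing L] {A B : AddSubgroup L}
    (hA : ∀ x ∈ A, ∀ y ∈ A, ⁅x, y⁆ = 0) (hB : ∀ x ∈ B, ∀ y ∈ B, ⁅x, y⁆ = 0)
    (hAB : A ⊔ B = ⊤) {a₁ a₂ b₁ b₂ : L} (ha₁ : a₁ ∈ A) (ha₂ : a₂ ∈ A) (hb₁ : b₁ ∈ B)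
    (hb₂ : b₂ ∈ B) : ⁅⁅a₁, b₁⁆, ⁅a₂, b₂⁆⁆ = 0 := by
  have decomp (x : L) : ∃ p ∈ A, ∃ q ∈ B, p + q = x :=
    AddSubgroup.mem_sup.mp (hAB ▸ AddSubgroup.mem_top x)
  obtain ⟨p₁₁, hp₁₁, q₁₁, hq₁₁, h₁₁⟩ := decomp ⁅a₁, b₁⁆
  obtain ⟨p₁₂, hp₁₂, q₁₂, hq₁₂, h₁₂⟩ := decomp ⁅a₁, b₂⁆
  obtain ⟨p₂₁, hp₂₁, q₂₁, hq₂₁, h₂₁⟩ := decomp ⁅a₂, b₁⁆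
  obtain ⟨p₂₂, hp₂₂, q₂₂, hq₂₂, h₂₂⟩ := decomp ⁅a₂, b₂⁆
  have lie_fst {a b p q y : L} (hb : b ∈ B) (hq : q ∈ B) (hy : y ∈ B) (h : p + q = ⁅a, b⁆) :
      ⁅p, y⁆ = ⁅⁅a, y⁆, b⁆ := by
    have e : ⁅⁅a, b⁆, y⁆ = ⁅⁅a, y⁆, b⁆ := by
      rw [lie_lie, hB b hb y hy, lie_zero, zero_sub, lie_skew]
    simpa [← h, hB q hq y hy] using e
  have lie_snd {a b p q x : L} (ha : a ∈ A) (hp : p ∈ A) (hx : x ∈ A) (h : p + q = ⁅a, b⁆) :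
      ⁅x, q⁆ = ⁅a, ⁅x, b⁆⁆ := by
    have e : ⁅x, ⁅a, b⁆⁆ = ⁅a, ⁅x, b⁆⁆ := by
      rw [leibniz_lie, hA x hx a ha, zero_lie, zero_add]
    simpa [← h, hA x hx p hp] using e
  have swap_right : ⁅p₁₁, q₂₂⁆ = ⁅p₁₂, q₂₁⁆ := by
    rw [lie_snd ha₂ hp₂₂ hp₁₁ h₂₂, lie_snd ha₂ hp₂₁ hp₁₂ h₂₁, lie_fst hb₁ hq₁₁ hb₂ h₁₁, ← h₁₂,
      add_lie, hB _ hq₁₂ _ hb₁, add_zero]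
  have swap_left : ⁅p₂₂, q₁₁⁆ = ⁅p₁₂, q₂₁⁆ := by
    rw [lie_fst hb₂ hq₂₂ hq₁₁ h₂₂, lie_fst hb₂ hq₁₂ hq₂₁ h₁₂, lie_snd ha₁ hp₁₁ ha₂ h₁₁, ← h₂₁,
      lie_add, hA _ ha₁ _ hp₂₁, zero_add]
  rw [← h₁₁, ← h₂₂, add_lie, lie_add, lie_add, hA _ hp₁₁ _ hp₂₂, hB _ hq₁₁ _ hq₂₂, swap_right,
    ← lie_skew q₁₁, swap_left]
  abel

/-- **Itô's theorem for Lie rings**: a Lie ring that is the sum of two additive subgroups on which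
the bracket vanishes is metabelian. -/
theorem lie_lie_lie_eq_zero_of_sup_eq_top {L : Type*} [LieRing L] {A B : AddSubgroup L}
    (hA : ∀ x ∈ A, ∀ y ∈ A, ⁅x, y⁆ = 0) (hB : ∀ x ∈ B, ∀ y ∈ B, ⁅x, y⁆ = 0)
    (hAB : A ⊔ B = ⊤) (x y z w : L) : ⁅⁅x, y⁆, ⁅z, w⁆⁆ = 0 := by
  have decomp (x : L) : ∃ p ∈ A, ∃ q ∈ B, p + q = x :=
    AddSubgroup.mem_sup.mp (hAB ▸ AddSubgroup.mem_top x)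
  have lie_eq (x y : L) :
      ∃ a ∈ A, ∃ b ∈ B, ∃ a' ∈ A, ∃ b' ∈ B, ⁅x, y⁆ = ⁅a, b⁆ - ⁅a', b'⁆ := by
    obtain ⟨a, ha, b, hb, rfl⟩ := decomp x
    obtain ⟨a', ha', b', hb', rfl⟩ := decomp y
    refine ⟨a, ha, b', hb', a', ha', b, hb, ?_⟩
    rw [add_lie, lie_add, lie_add, hA a ha a' ha', hB b hb b' hb', ← lie_skew b a']
    abel
  obtain ⟨a₁, ha₁, b₁, hb₁, a₂, ha₂, b₂, hb₂, h⟩ := lie_eq x y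
  obtain ⟨a₃, ha₃, b₃, hb₃, a₄, ha₄, b₄, hb₄, h'⟩ := lie_eq z w
  have key {a a' b b' : L} (ha : a ∈ A) (ha' : a' ∈ A) (hb : b ∈ B) (hb' : b' ∈ B) :
      ⁅⁅a, b⁆, ⁅a', b'⁆⁆ = 0 := lie_lie_lie_eq_zero_of_mem hA hB hAB ha ha' hb hb'
  rw [h, h', sub_lie, lie_sub, lie_sub, key ha₁ ha₃ hb₁ hb₃, key ha₁ ha₄ hb₁ hb₄,
    key ha₂ ha₃ hb₂ hb₃, key ha₂ ha₄ hb₂ hb₄]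
  simp

/-- The map `x ↦ 1 ⊗ x + c ⊗ J x` into the complexification; for `c = ∓ i` its range is the
`±i`-eigenspace of a complex structure `J`. -/
noncomputable def eigenvectorMap {g : Type*} [AddCommGroup g] [Module ℝ g] (J : g →ₗ[ℝ] g) (c : ℂ) :
    g →ₗ[ℝ] ℂ ⊗[ℝ] g :=
  TensorProduct.mk ℝ ℂ g 1 + TensorProduct.mk ℝ ℂ g c ∘ₗ J

theorem eigenvectorMap_apply {g : Type*} [AddCommGroup g] [Module ℝ g] (J : g →ₗ[ℝ] g) (c : ℂ)
    (x : g) : eigenvectorMap J c x = 1 ⊗ₜ x + c ⊗ₜ J x := rfl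

theorem lie_eigenvectorMap {g : Type*} [LieRing g] [LieAlgebra ℝ g] {J : g →ₗ[ℝ] g}
    (hJ : ∀ x, J (J x) = -x) (habel : ∀ x y : g, ⁅J x, J y⁆ = ⁅x, y⁆) {c : ℂ} (hc : c * c = -1)
    (x y : g) : ⁅eigenvectorMap J c x, eigenvectorMap J c y⁆ = 0 := by
  have hxy : ⁅J x, y⁆ = -⁅x, J y⁆ := by
    rw [← habel (J x) y, hJ, neg_lie]
  simp only [eigenvectorMap_apply, add_lie, lie_add, LieAlgebra.ExtendScalars.bracket_tmul, hc,
    habel, hxy, one_mul, mul_one, TensorProduct.neg_tmul, TensorProduct.tmul_neg]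
  abel

theorem range_eigenvectorMap_sup_eq_top {g : Type*} [AddCommGroup g] [Module ℝ g] {J : g →ₗ[ℝ] g}
    (hJ : ∀ x, J (J x) = -x) :
    LinearMap.range (eigenvectorMap J (-Complex.I)) ⊔ LinearMap.range (eigenvectorMap J Complex.I)
      = ⊤ := by
  set S := LinearMap.range (eigenvectorMap J (-Complex.I)) ⊔
    LinearMap.range (eigenvectorMap J Complex.I)
  have mem_left (x : g) : eigenvectorMap J (-Complex.I) x ∈ S :=
    Submodule.mem_sup_left (LinearMap.mem_range_self _ x)
  have mem_right (x : g) : eigenvectorMap J Complex.I x ∈ S :=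
    Submodule.mem_sup_right (LinearMap.mem_range_self _ x)
  have one_mem (x : g) : (1 : ℂ) ⊗ₜ[ℝ] x ∈ S := by
    convert S.smul_mem (1 / 2 : ℝ) (S.add_mem (mem_left x) (mem_right x)) using 1
    simp only [eigenvectorMap_apply, TensorProduct.neg_tmul]
    module
  have I_mem (x : g) : Complex.I ⊗ₜ[ℝ] x ∈ S := by
    convert S.sub_mem (one_mem (J x)) (mem_right (J x)) using 1
    simp [eigenvectorMap_apply, hJ, TensorProduct.tmul_neg]
  refine eq_top_iff.mpr fun t _ => ?_
  induction t with
  | zero => exact S.zero_mem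
  | add s t hs ht => exact S.add_mem (hs trivial) (ht trivial)
  | tmul z x =>
    have hz : z = z.re • (1 : ℂ) + z.im • Complex.I := by
      simp [Complex.re_add_im]
    rw [hz, TensorProduct.add_tmul, ← TensorProduct.smul_tmul', ← TensorProduct.smul_tmul']
    exact S.add_mem (S.smul_mem _ (one_mem x)) (S.smul_mem _ (I_mem x))

/-- A real Lie algebra admitting an abelian complex structure is 2-step
solvable: `⁅⁅x,y⁆,⁅z,w⁆⁆ = 0` for all `x, y, z, w`. -/
theorem two_step_solvable_of_abelian_complex_structure (g : Type*) [LieRing g] [LieAlgebra ℝ g]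
    (J : g →ₗ[ℝ] g) (hJ : ∀ x, J (J x) = -x)
    (habel : ∀ x y : g, ⁅J x, J y⁆ = ⁅x, y⁆) :
    ∀ x y z w : g, ⁅⁅x, y⁆, ⁅z, w⁆⁆ = 0 := by
  intro x y z w
  have lie_range {c : ℂ} (hc : c * c = -1) :
      ∀ s ∈ (LinearMap.range (eigenvectorMap J c)).toAddSubgroup,
        ∀ t ∈ (LinearMap.range (eigenvectorMap J c)).toAddSubgroup, ⁅s, t⁆ = 0 := by
    rintro _ ⟨u, rfl⟩ _ ⟨v, rfl⟩
    exact lie_eigenvectorMap hJ habel hc u v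
  have h := lie_lie_lie_eq_zero_of_sup_eq_top (lie_range (c := -Complex.I) (by simp))
    (lie_range (c := Complex.I) (by simp))
    (by rw [← Submodule.sup_toAddSubgroup, range_eigenvectorMap_sup_eq_top hJ]; rfl)
    ((1 : ℂ) ⊗ₜ[ℝ] x) (1 ⊗ₜ y) (1 ⊗ₜ z) (1 ⊗ₜ w)
  simp only [LieAlgebra.ExtendScalars.bracket_tmul, mul_one] at h
  simpa using congrArg (fun t => TensorProduct.lid ℝ g (Complex.reLm.rTensor g t)) h
end

section
/- Let L be a Lie algebra over a field of characteristic zero, and suppose L = A + B as a vector space, where A and B are abelian Lie subalgebras of L (i.e. [A,A] = 0 and [B,B] = 0). Then L is 2-step solvable: [[x,y],[z,w]] = 0 for all x, y, z, w ∈ L. -/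
/-- If two families of commuting elements `A` and `B` of a Lie ring satisfy `L = A + B`, then the
brackets of elements of `A` with elements of `B` commute with each other. -/
theorem lie_lie_lie_eq_zero_of_forall_exists_add {L : Type*} [LieRing L] {A B : Set L}
    (hA : ∀ a ∈ A, ∀ a' ∈ A, ⁅a, a'⁆ = (0 : L))
    (hB : ∀ b ∈ B, ∀ b' ∈ B, ⁅b, b'⁆ = (0 : L))
    (hsum : ∀ x : L, ∃ a ∈ A, ∃ b ∈ B, x = a + b)
    {a a' b b' : L} (ha : a ∈ A) (ha' : a' ∈ A) (hb : b ∈ B) (hb' : b' ∈ B) :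
    ⁅⁅a, b⁆, ⁅a', b'⁆⁆ = 0 := by
  obtain ⟨p, hp, q, hq, hpq⟩ := hsum ⁅a, b'⁆
  obtain ⟨r, hr, s, hs, hrs⟩ := hsum ⁅a', b⁆
  have h_left : ⁅⁅a, b⁆, a'⁆ = -⁅a, s⁆ := by
    rw [lie_lie, hA a ha a' ha', lie_zero, sub_zero, ← lie_skew b a', hrs, lie_neg, lie_add,
      hA a ha r hr, zero_add]
  have h_right : ⁅⁅a, b⁆, b'⁆ = ⁅p, b⁆ := by
    rw [lie_lie, hB b hb b' hb', lie_zero, zero_sub, hpq, lie_skew, add_lie, hB q hq b hb,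
      add_zero]
  have h_ps : ⁅⁅a, s⁆, b'⁆ = ⁅p, s⁆ := by
    rw [lie_lie, hB s hs b' hb', lie_zero, zero_sub, hpq, lie_skew, add_lie, hB q hq s hs,
      add_zero]
  have h_ps' : ⁅a', ⁅p, b⁆⁆ = ⁅p, s⁆ := by
    rw [leibniz_lie, hA a' ha' p hp, zero_lie, zero_add, hrs, lie_add, hA p hp r hr, zero_add]
  rw [leibniz_lie, h_left, h_right, neg_lie, h_ps, h_ps', neg_add_cancel]

/-- If a Lie algebra `L` over a field of characteristic zero is the vector-space
sum of two abelian Lie subalgebras `A` and `B`, then `L` is 2-step solvable: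
`⁅⁅x,y⁆,⁅z,w⁆⁆ = 0` for all `x, y, z, w ∈ L`. -/
theorem two_step_solvable_of_sum_of_abelian_subalgebras
    (K : Type*) [Field K] [CharZero K]
    (L : Type*) [LieRing L] [LieAlgebra K L]
    (A B : LieSubalgebra K L)
    (hA : ∀ a ∈ A, ∀ a' ∈ A, ⁅a, a'⁆ = (0 : L))
    (hB : ∀ b ∈ B, ∀ b' ∈ B, ⁅b, b'⁆ = (0 : L))
    (hsum : ∀ x : L, ∃ a ∈ A, ∃ b ∈ B, x = a + b) :
    ∀ x y z w : L, ⁅⁅x, y⁆, ⁅z, w⁆⁆ = 0 := by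
  intro x y z w
  obtain ⟨a, ha, b, hb, rfl⟩ := hsum x
  obtain ⟨a', ha', b', hb', rfl⟩ := hsum y
  obtain ⟨c, hc, d, hd, rfl⟩ := hsum z
  obtain ⟨c', hc', d', hd', rfl⟩ := hsum w
  have h_lie {a a' b b' : L} (ha : a ∈ A) (ha' : a' ∈ A) (hb : b ∈ B) (hb' : b' ∈ B) :
      ⁅a + b, a' + b'⁆ = ⁅a, b'⁆ - ⁅a', b⁆ := by
    rw [add_lie, lie_add, lie_add, hA a ha a' ha', hB b hb b' hb', ← lie_skew b a']
    abel
  have h_comm {a a' b b' : L} (ha : a ∈ A) (ha' : a' ∈ A) (hb : b ∈ B) (hb' : b' ∈ B) :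
      ⁅⁅a, b⁆, ⁅a', b'⁆⁆ = 0 :=
    lie_lie_lie_eq_zero_of_forall_exists_add (A := (A : Set L)) (B := (B : Set L))
      hA hB hsum ha ha' hb hb'
  rw [h_lie ha ha' hb hb', h_lie hc hc' hd hd', sub_lie, lie_sub, lie_sub,
    h_comm ha hc hb' hd', h_comm ha hc' hb' hd, h_comm ha' hc hb hd', h_comm ha' hc' hb hd]
  simp
end

section
/- Let g be a real Lie algebra and J : g → g an ℝ-linear map with J² = −id whose Nijenhuis tensor vanishes identically. Then there exists an ℝ-bilinear map B : g × g → g which is complex, i.e. B(x,Jy) = J B(x,y) for all x, y, and whose torsion T(x,y) = B(x,y) − B(y,x) − [x,y] is of type (1,1), i.e. T(Jx,Jy) = T(x,y) for all x, y. (For instance, B(x,y) = (1/4)([x,y] − J[x,Jy]) works.) -/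
/-- Proposition 2.3 (iv), at the Lie-algebra level: if the Nijenhuis tensor of
`J` vanishes identically, then there exists a complex bilinear map `B`
(i.e. `B x (Jy) = J (B x y)`) whose torsion `T x y = B x y - B y x - ⁅x,y⁆`
is of type `(1,1)` (`T (Jx) (Jy) = T x y`). -/
theorem exists_complex_connection_torsion_one_one (g : Type*) [LieRing g] [LieAlgebra ℝ g]
    (J : g →ₗ[ℝ] g) (hJ : ∀ x, J (J x) = -x)
    (hN : ∀ x y : g, ⁅J x, J y⁆ - J ⁅x, J y⁆ - J ⁅J x, y⁆ - ⁅x, y⁆ = 0) :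
    ∃ B : g →ₗ[ℝ] g →ₗ[ℝ] g,
      (∀ x y : g, B x (J y) = J (B x y)) ∧
      (∀ x y : g,
        B (J x) (J y) - B (J y) (J x) - ⁅J x, J y⁆ = B x y - B y x - ⁅x, y⁆) := by
  refine ⟨LinearMap.mk₂ ℝ (fun x y => (1 / 4 : ℝ) • (⁅x, y⁆ - J ⁅x, J y⁆)) ?_ ?_ ?_ ?_, ?_, ?_⟩
  · intro x x' y
    simp only [add_lie, map_add]
    module
  · intro c x y
    simp only [smul_lie, map_smul]
    module
  · intro x y y'
    simp only [lie_add, map_add]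
    module
  · intro c x y
    simp only [lie_smul, map_smul]
    module
  · intro x y
    simp only [LinearMap.mk₂_apply, hJ, lie_neg, map_neg, map_sub, map_smul]
    module
  · intro x y
    have h : ⁅J x, J y⁆ = J ⁅x, J y⁆ + J ⁅J x, y⁆ + ⁅x, y⁆ := by
      rw [← sub_eq_zero, ← hN x y]
      abel
    simp only [LinearMap.mk₂_apply, hJ, lie_neg, map_neg]
    rw [← lie_skew (J y) (J x), ← lie_skew y x, ← lie_skew (J y) x, ← lie_skew y (J x), h]
    simp only [map_neg]
    module
end

section
/- Let g be a finite-dimensional real Lie algebra and J : g → g an ℝ-linear map with J² = −id whose Nijenhuis tensor vanishes identically. Then there exists an ℝ-bilinear map B : g × g → g which is complex, i.e. B(x,Jy) = J B(x,y) for all x, y, and whose torsion T(x,y) = B(x,y) − B(y,x) − [x,y] is of type (2,0), i.e. T(Jx,y) = J T(x,y) for all x, y. -/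
/-- Proposition 2.3 (v), at the Lie-algebra level: if `g` is finite-dimensional
and the Nijenhuis tensor of `J` vanishes identically, then there exists a
complex bilinear map `B` (i.e. `B x (Jy) = J (B x y)`) whose torsion
`T x y = B x y - B y x - ⁅x,y⁆` is of type `(2,0)` (`T (Jx) y = J (T x y)`). -/
theorem exists_complex_connection_torsion_two_zero (g : Type*) [LieRing g] [LieAlgebra ℝ g]
    [FiniteDimensional ℝ g]
    (J : g →ₗ[ℝ] g) (hJ : ∀ x, J (J x) = -x)
    (hN : ∀ x y : g, ⁅J x, J y⁆ - J ⁅x, J y⁆ - J ⁅J x, y⁆ - ⁅x, y⁆ = 0) :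
    ∃ B : g →ₗ[ℝ] g →ₗ[ℝ] g,
      (∀ x y : g, B x (J y) = J (B x y)) ∧
      (∀ x y : g,
        B (J x) y - B y (J x) - ⁅J x, y⁆ = J (B x y - B y x - ⁅x, y⁆)) := by
  -- `B x` is the `J`-linear part of `ad x`.
  refine ⟨LinearMap.mk₂ ℝ (fun x y => (2⁻¹ : ℝ) • (⁅x, y⁆ - J ⁅x, J y⁆)) ?_ ?_ ?_ ?_, ?_, ?_⟩
  · intro x x' y
    simp only [add_lie, map_add]
    module
  · intro c x y
    simp only [smul_lie, map_smul]
    module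
  · intro x y y'
    simp only [lie_add, map_add]
    module
  · intro c x y
    simp only [lie_smul, map_smul]
    module
  · intro x y
    simp only [LinearMap.mk₂_apply, hJ, lie_neg, map_neg, map_sub, map_smul]
    module
  · intro x y
    have h := congrArg J (hN x y)
    simp only [map_sub, hJ, map_zero] at h
    simp only [LinearMap.mk₂_apply, hJ, lie_neg, map_neg, map_sub, map_smul]
    linear_combination (norm := module) (-2⁻¹ : ℝ) • h
end
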